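/- For any probability distributions P and Q on the same finite index set (nonnegative real entries summing to 1), DL(P, Q) = 0 if and only if P = Q (i.e., P i = Q i for every index i). -/

import Mathlib

open Real Finset

/-- lit(p,q) = |p(1 - log p) - q(1 - log q)|, natural log, with 0*log 0 = 0
(automatic since Real.log 0 = 0). -/
noncomputable def lit (p q : ℝ) : ℝ :=
  |p * (1 - Real.log p) - q * (1 - Real.log q)|

/-- δh(p,q) = |p²(1 - 2 log p) - q²(1 - 2 log q)| / (2(p+q)), with δh(0,0) = 0
(automatic since division by zero is 0 in Lean). -/
noncomputable def deltaH (p q : ℝ) : ℝ :=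
  |p ^ 2 * (1 - 2 * Real.log p) - q ^ 2 * (1 - 2 * Real.log q)| / (2 * (p + q))

/-- dl(p,q) = lit(p,q) - δh(p,q). -/
noncomputable def dl (p q : ℝ) : ℝ := lit p q - deltaH p q

/-- DLITE of two distributions on a finite index set: DL(P,Q) = ∑ i, dl(P i, Q i). -/
noncomputable def DL {ι : Type*} [Fintype ι] (P Q : ι → ℝ) : ℝ :=
  ∑ i, dl (P i) (Q i)

/-- `IsProbDist P` : nonnegative real entries summing to 1. -/
def IsProbDist {ι : Type*} [Fintype ι] (P : ι → ℝ) : Prop :=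
  (∀ i, 0 ≤ P i) ∧ ∑ i, P i = 1

/-- For `0 < q < p`, the logarithmic mean inequality `2 p q log (p / q) < p² - q²`. -/
lemma two_mul_log_sub_log_lt_sq_sub_sq {p q : ℝ} (hq : 0 < q) (hqp : q < p) :
    2 * p * q * (Real.log p - Real.log q) < p ^ 2 - q ^ 2 := by
  have hp : 0 < p := hq.trans hqp
  have h := Real.self_lt_sinh_iff.2 (Real.log_pos ((one_lt_div hq).2 hqp))
  rw [Real.sinh_log (div_pos hp hq), Real.log_div hp.ne' hq.ne'] at h
  have hpq : 0 < 2 * p * q := by positivity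
  calc
    _ < 2 * p * q * ((p / q - (p / q)⁻¹) / 2) := mul_lt_mul_of_pos_left h hpq
    _ = p ^ 2 - q ^ 2 := by field_simp

lemma mul_one_sub_log_le {p q : ℝ} (hq : 0 ≤ q) (hqp : q ≤ p) (hp1 : p ≤ 1) :
    q * (1 - Real.log q) ≤ p * (1 - Real.log p) := by
  have hlog : Real.log p ≤ 0 := Real.log_nonpos (hq.trans hqp) hp1
  rcases hq.eq_or_lt with rfl | hq
  · nlinarith
  have hp : 0 < p := hq.trans_le hqp
  have h := Real.log_le_sub_one_of_pos (div_pos hp hq)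
  rw [Real.log_div hp.ne' hq.ne', div_sub_one hq.ne', le_div_iff₀ hq] at h
  nlinarith

lemma dl_comm (p q : ℝ) : dl p q = dl q p := by
  simp only [dl, lit, deltaH, abs_sub_comm, add_comm]

lemma dl_self (p : ℝ) : dl p p = 0 := by
  simp [dl, lit, deltaH]

lemma dl_pos_of_lt {p q : ℝ} (hq : 0 ≤ q) (hqp : q < p) (hp1 : p ≤ 1) : 0 < dl p q := by
  have hp : 0 < p := hq.trans_lt hqp
  have hf := mul_one_sub_log_le hq hqp.le hp1
  have hg := mul_one_sub_log_le (sq_nonneg q) (pow_le_pow_left₀ hq hqp.le 2)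
    (pow_le_one₀ hp.le hp1)
  simp only [Real.log_pow, Nat.cast_ofNat] at hg
  have hkey : 2 * p * q * (Real.log p - Real.log q) < p ^ 2 - q ^ 2 := by
    rcases hq.eq_or_lt with rfl | hq
    · simpa using pow_pos hp 2
    · exact two_mul_log_sub_log_lt_sq_sub_sq hq hqp
  rw [dl, lit, deltaH, abs_of_nonneg (sub_nonneg.2 hf), abs_of_nonneg (sub_nonneg.2 hg), sub_pos,
    div_lt_iff₀ (by positivity)]
  linarith

lemma dl_pos_of_ne {p q : ℝ} (hp : 0 ≤ p) (hp1 : p ≤ 1) (hq : 0 ≤ q) (hq1 : q ≤ 1)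
    (h : p ≠ q) : 0 < dl p q := by
  rcases h.lt_or_gt with h | h
  · rw [dl_comm]
    exact dl_pos_of_lt hp h hq1
  · exact dl_pos_of_lt hq h hp1

lemma IsProbDist.le_one {ι : Type*} [Fintype ι] {P : ι → ℝ} (hP : IsProbDist P) (i : ι) :
    P i ≤ 1 :=
  hP.2 ▸ Finset.single_le_sum (fun j _ => hP.1 j) (Finset.mem_univ i)

theorem DL_eq_zero_iff {ι : Type*} [Fintype ι] (P Q : ι → ℝ)
    (hP : IsProbDist P) (hQ : IsProbDist Q) :
    DL P Q = 0 ↔ ∀ i, P i = Q i := by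
  have hpos (i : ι) (h : P i ≠ Q i) : 0 < dl (P i) (Q i) :=
    dl_pos_of_ne (hP.1 i) (hP.le_one i) (hQ.1 i) (hQ.le_one i) h
  have hnonneg (i : ι) : 0 ≤ dl (P i) (Q i) := by
    by_cases h : P i = Q i
    · rw [h, dl_self]
    · exact (hpos i h).le
  constructor
  · intro h i
    by_contra hne
    exact (hpos i hne).ne'
      ((Finset.sum_eq_zero_iff_of_nonneg fun j _ => hnonneg j).1 h i (Finset.mem_univ i))
  · intro h
    exact Finset.sum_eq_zero fun i _ => by rw [h i, dl_self]
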